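/- Let 0<α<1 and 0<β<∞, let u be holomorphic on 𝔻 and φ a holomorphic self-map of 𝔻. If the weighted composition operator uC_φ maps B^α boundedly into H^∞_{ν_β}, then uC_φ : B^α → H^∞_{ν_β} is compact. -/

import Mathlib

open Complex Filter Set

noncomputable section

/-- The open unit disk in `ℂ`. -/
def unitDisk : Set ℂ := Metric.ball 0 1

/-- The weighted sup-norm `‖g‖_{ν_γ} = sup_{z ∈ 𝔻} (1-|z|²)^γ |g(z)|`. -/
def wnorm (γ : ℝ) (g : ℂ → ℂ) : ℝ :=
  sSup ((fun z => (1 - ‖z‖ ^ 2) ^ γ * ‖g z‖) '' unitDisk)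

/-- Membership in the weighted Banach space `H^∞_{ν_β}`. -/
def MemWeighted (β : ℝ) (g : ℂ → ℂ) : Prop :=
  DifferentiableOn ℂ g unitDisk ∧
    BddAbove ((fun z => (1 - ‖z‖ ^ 2) ^ β * ‖g z‖) '' unitDisk)

/-- Membership in the Bloch type space `B^α`. -/
def MemBloch (α : ℝ) (f : ℂ → ℂ) : Prop :=
  DifferentiableOn ℂ f unitDisk ∧
    BddAbove ((fun z => (1 - ‖z‖ ^ 2) ^ α * ‖deriv f z‖) '' unitDisk)

/-- The Bloch type norm `‖f‖_{B^α} = |f(0)| + sup_{z∈𝔻}(1-|z|²)^α |f'(z)|`. -/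
def blochNorm (α : ℝ) (f : ℂ → ℂ) : ℝ :=
  ‖f 0‖ + wnorm α (deriv f)

/-- Membership in the Zygmund type space `Z_β`. -/
def MemZygmund (β : ℝ) (f : ℂ → ℂ) : Prop :=
  DifferentiableOn ℂ f unitDisk ∧
    BddAbove ((fun z => (1 - ‖z‖ ^ 2) ^ β * ‖deriv (deriv f) z‖) '' unitDisk)

/-- The Zygmund type norm `‖f‖_{Z_β} = |f(0)| + |f'(0)| + sup_{z∈𝔻}(1-|z|²)^β |f''(z)|`. -/
def zygNorm (β : ℝ) (f : ℂ → ℂ) : ℝ :=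
  ‖f 0‖ + ‖deriv f 0‖ + wnorm β (deriv (deriv f))

/-- The weighted composition operator `uC_φ f = u · (f ∘ φ)`. -/
def wcomp (u φ f : ℂ → ℂ) : ℂ → ℂ := fun z => u z * f (φ z)

/-- `uC_φ` maps `B^α` boundedly into `Z_β`. -/
def BoundedBlochToZygmund (α β : ℝ) (u φ : ℂ → ℂ) : Prop :=
  (∀ f, MemBloch α f → MemZygmund β (wcomp u φ f)) ∧
    ∃ C > 0, ∀ f, MemBloch α f → zygNorm β (wcomp u φ f) ≤ C * blochNorm α f

/-- `uC_φ` maps `B^α` boundedly into `H^∞_{ν_β}`. -/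
def BoundedBlochToWeighted (α β : ℝ) (u φ : ℂ → ℂ) : Prop :=
  (∀ f, MemBloch α f → MemWeighted β (wcomp u φ f)) ∧
    ∃ C > 0, ∀ f, MemBloch α f → wnorm β (wcomp u φ f) ≤ C * blochNorm α f

/-- `uC_φ : B^α → Z_β` is compact: it is bounded and maps bounded sets of `B^α` to
totally bounded (equivalently, since `Z_β` is complete, relatively compact) subsets
of `Z_β`. -/
def CompactBlochToZygmund (α β : ℝ) (u φ : ℂ → ℂ) : Prop :=
  BoundedBlochToZygmund α β u φ ∧
    ∀ r : ℝ, ∀ ε : ℝ, 0 < ε → ∃ T : Finset (ℂ → ℂ),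
      (∀ g ∈ T, MemZygmund β g) ∧
      ∀ f, MemBloch α f → blochNorm α f ≤ r →
        ∃ g ∈ T, zygNorm β (fun z => wcomp u φ f z - g z) ≤ ε

/-- `uC_φ : B^α → H^∞_{ν_β}` is compact: it is bounded and maps bounded sets of `B^α`
to totally bounded (equivalently, relatively compact) subsets of `H^∞_{ν_β}`. -/
def CompactBlochToWeighted (α β : ℝ) (u φ : ℂ → ℂ) : Prop :=
  BoundedBlochToWeighted α β u φ ∧
    ∀ r : ℝ, ∀ ε : ℝ, 0 < ε → ∃ T : Finset (ℂ → ℂ),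
      (∀ g ∈ T, MemWeighted β g) ∧
      ∀ f, MemBloch α f → blochNorm α f ≤ r →
        ∃ g ∈ T, wnorm β (fun z => wcomp u φ f z - g z) ≤ ε

/-- A compact (linear, bounded, with totally bounded image of the unit ball) operator
from the subspace of `B^α` cut out by the predicate `P` into `Z_β`. -/
def IsCompactOpToZygmund (α β : ℝ) (P : (ℂ → ℂ) → Prop) (K : (ℂ → ℂ) → ℂ → ℂ) : Prop :=
  (∀ f g, P f → P g → ∀ a b : ℂ,
      K (fun z => a * f z + b * g z) = fun z => a * K f z + b * K g z) ∧
  (∀ f, P f → MemZygmund β (K f)) ∧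
  (∃ C, ∀ f, P f → zygNorm β (K f) ≤ C * blochNorm α f) ∧
  (∀ ε : ℝ, 0 < ε → ∃ T : Finset (ℂ → ℂ), (∀ g ∈ T, MemZygmund β g) ∧
      ∀ f, P f → blochNorm α f ≤ 1 → ∃ g ∈ T, zygNorm β (fun z => K f z - g z) ≤ ε)

/-- The essential norm of `uC_φ`, as an operator from the subspace of `B^α` cut out by
the predicate `P` into `Z_β`: the distance to the compact operators, the operator norm
being the supremum over the unit ball. -/
def essNormZ (α β : ℝ) (P : (ℂ → ℂ) → Prop) (u φ : ℂ → ℂ) : ℝ :=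
  sInf {r | ∃ K, IsCompactOpToZygmund α β P K ∧
    r = sSup {s | ∃ f, P f ∧ blochNorm α f ≤ 1 ∧
          s = zygNorm β (fun z => wcomp u φ f z - K f z)}}

/-- A compact (linear, bounded, with totally bounded image of the unit ball) operator
from `B^α` into `H^∞_{ν_β}`. -/
def IsCompactOpToWeighted (α β : ℝ) (K : (ℂ → ℂ) → ℂ → ℂ) : Prop :=
  (∀ f g, MemBloch α f → MemBloch α g → ∀ a b : ℂ,
      K (fun z => a * f z + b * g z) = fun z => a * K f z + b * K g z) ∧
  (∀ f, MemBloch α f → MemWeighted β (K f)) ∧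
  (∃ C, ∀ f, MemBloch α f → wnorm β (K f) ≤ C * blochNorm α f) ∧
  (∀ ε : ℝ, 0 < ε → ∃ T : Finset (ℂ → ℂ), (∀ g ∈ T, MemWeighted β g) ∧
      ∀ f, MemBloch α f → blochNorm α f ≤ 1 → ∃ g ∈ T, wnorm β (fun z => K f z - g z) ≤ ε)

/-- The essential norm of `uC_φ : B^α → H^∞_{ν_β}`. -/
def essNormW (α β : ℝ) (u φ : ℂ → ℂ) : ℝ :=
  sInf {r | ∃ K, IsCompactOpToWeighted α β K ∧
    r = sSup {s | ∃ f, MemBloch α f ∧ blochNorm α f ≤ 1 ∧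
          s = wnorm β (fun z => wcomp u φ f z - K f z)}}

/-- `limsup_{|φ(z)|→1} F(z) = lim_{s→1⁻} sup {F z : z ∈ 𝔻, |φ z| > s}`.  Since the inner
supremum is nonincreasing in `s`, the limit equals the infimum over `s ∈ [0,1)`; note
that `Real.sSup ∅ = 0`, matching the convention that the value is `0` when
`{z : |φ z| > s}` is empty for some `s < 1`. -/
def phiLimsup (φ : ℂ → ℂ) (F : ℂ → ℝ) : ℝ :=
  sInf ((fun s => sSup {y | ∃ z ∈ unitDisk, s < ‖φ z‖ ∧ y = F z}) '' Set.Ico (0:ℝ) 1)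

/-- A bounded family of functions is approximated on a finite set by finitely many members. -/
lemma exists_finite_subset_approx {X E : Type*} [NormedAddCommGroup E] [ProperSpace E]
    (F : Set (X → E)) {N : Set X} (hN : N.Finite) (R : ℝ)
    (hR : ∀ f ∈ F, ∀ z ∈ N, ‖f z‖ ≤ R) {ε : ℝ} (hε : 0 < ε) :
    ∃ T ⊆ F, T.Finite ∧ ∀ f ∈ F, ∃ g ∈ T, ∀ z ∈ N, ‖f z - g z‖ < ε := by
  have := hN.fintype
  have htb : TotallyBounded (N.domRestrict '' F : Set (N → E)) := by
    refine (isCompact_closedBall (0 : N → E) (max R 0)).totallyBounded.subset ?_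
    rintro _ ⟨f, hf, rfl⟩
    rw [mem_closedBall_zero_iff, pi_norm_le_iff_of_nonneg (le_max_right _ _)]
    exact fun z => (hR f hf z z.2).trans (le_max_left _ _)
  obtain ⟨T, hTF, hT, hcov⟩ :=
    exists_subset_image_finite_and.1 (Metric.finite_approx_of_totallyBounded htb ε hε)
  refine ⟨T, hTF, hT, fun f hf => ?_⟩
  obtain ⟨_, ⟨g, hg, rfl⟩, hfg⟩ := mem_iUnion₂.1 (hcov (mem_image_of_mem _ hf))
  refine ⟨g, hg, fun z hz => ?_⟩
  rw [Metric.mem_ball, dist_pi_lt_iff hε] at hfg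
  exact dist_eq_norm (f z) (g z) ▸ hfg ⟨z, hz⟩

lemma one_sub_norm_sq_pos {z : ℂ} (hz : z ∈ unitDisk) : 0 < 1 - ‖z‖ ^ 2 := by
  have h : ‖z‖ < 1 := mem_ball_zero_iff.1 hz
  nlinarith [norm_nonneg z]

lemma wnorm_nonneg (γ : ℝ) (g : ℂ → ℂ) : 0 ≤ wnorm γ g := by
  apply Real.sSup_nonneg
  rintro _ ⟨z, hz, rfl⟩
  have := one_sub_norm_sq_pos hz
  positivity

lemma norm_apply_zero_le_blochNorm (α : ℝ) (f : ℂ → ℂ) : ‖f 0‖ ≤ blochNorm α f :=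
  le_add_of_nonneg_right (wnorm_nonneg _ _)

lemma MemBloch.norm_deriv_le {α : ℝ} {f : ℂ → ℂ} (hf : MemBloch α f) {z : ℂ}
    (hz : z ∈ unitDisk) : ‖deriv f z‖ ≤ blochNorm α f * (1 - ‖z‖ ^ 2) ^ (-α) := by
  have hpos := one_sub_norm_sq_pos hz
  have h : (1 - ‖z‖ ^ 2) ^ α * ‖deriv f z‖ ≤ blochNorm α f :=
    (le_csSup hf.2 (mem_image_of_mem _ hz)).trans (le_add_of_nonneg_left (norm_nonneg _))
  rw [Real.rpow_neg hpos.le, ← div_eq_mul_inv, le_div_iff₀ (Real.rpow_pos_of_pos hpos _),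
    mul_comm]
  exact h

/-- Growth estimate along a radius for Bloch type functions with exponent less than one. -/
lemma MemBloch.norm_sub_dilation_le {α : ℝ} (hα0 : 0 < α) (hα1 : α < 1) {f : ℂ → ℂ}
    (hf : MemBloch α f) {s : ℝ} (hs0 : 0 ≤ s) (hs1 : s ≤ 1) {z : ℂ} (hz : z ∈ unitDisk) :
    ‖f z - f (s * z)‖ ≤ blochNorm α f * (1 - s) ^ (1 - α) / (1 - α) := by
  have hz1 : ‖z‖ < 1 := mem_ball_zero_iff.1 hz
  have hnn : 0 ≤ blochNorm α f := (norm_nonneg _).trans (norm_apply_zero_le_blochNorm α f)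
  have hα : 0 < 1 - α := sub_pos.2 hα1
  have hnorm : ∀ t ∈ Icc s 1, ‖(t : ℂ) * z‖ ≤ t * ‖z‖ := fun t ht => by
    rw [norm_mul, norm_real, Real.norm_of_nonneg (hs0.trans ht.1)]
  have hmem : ∀ t ∈ Icc s 1, (t : ℂ) * z ∈ unitDisk := fun t ht =>
    mem_ball_zero_iff.2 <| (hnorm t ht).trans_lt <| by
      nlinarith [ht.1, ht.2, norm_nonneg z]
  have hder : ∀ t ∈ Icc s 1,
      HasDerivAt (fun t : ℝ => f (t * z) - f (s * z)) (deriv f (t * z) * z) t := fun t ht => by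
    have h1 : HasDerivAt f (deriv f (t * z)) (t * z) :=
      (hf.1.differentiableAt (Metric.isOpen_ball.mem_nhds (hmem t ht))).hasDerivAt
    have h2 : HasDerivAt (fun w : ℂ => w * z) z (t : ℂ) := by
      simpa using (hasDerivAt_id (t : ℂ)).mul_const z
    exact ((HasDerivAt.comp (t : ℂ) h1 h2).comp_ofReal).sub_const _
  have hBc : ContinuousOn (fun t : ℝ =>
      blochNorm α f * ((1 - s) ^ (1 - α) - (1 - t) ^ (1 - α)) / (1 - α)) (Icc s 1) := by
    refine ((continuousOn_const.mul (continuousOn_const.sub ?_)).div_const _)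
    exact (continuous_const.sub continuous_id).continuousOn.rpow_const fun _ _ => Or.inr hα.le
  have hBd : ∀ t ∈ Ico s 1, HasDerivWithinAt (fun t : ℝ =>
      blochNorm α f * ((1 - s) ^ (1 - α) - (1 - t) ^ (1 - α)) / (1 - α))
      (blochNorm α f * (1 - t) ^ (-α)) (Ici t) t := fun t ht => by
    have h1 : HasDerivAt (fun t : ℝ => 1 - t) (-1) t := by
      simpa using (hasDerivAt_id t).const_sub 1
    have h2 := h1.rpow_const (p := 1 - α) (Or.inl (sub_pos.2 ht.2).ne')
    have h3 := ((h2.const_sub ((1 - s) ^ (1 - α))).const_mul (blochNorm α f)).div_const (1 - α)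
    refine (h3.congr_deriv ?_).hasDerivWithinAt
    rw [show 1 - α - 1 = -α by ring]
    field_simp
  have key := image_norm_le_of_norm_deriv_right_le_deriv_boundary'
    (fun t ht => (hder t ht).continuousAt.continuousWithinAt)
    (fun t ht => (hder t (Ico_subset_Icc_self ht)).hasDerivWithinAt)
    (by simp) hBc hBd (fun t ht => ?_) (right_mem_Icc.2 hs1)
  · simpa [Real.zero_rpow hα.ne'] using key
  · have ht' := Ico_subset_Icc_self ht
    have ht1 : 0 < 1 - t := sub_pos.2 ht.2
    have hle : 1 - t ≤ 1 - ‖(t : ℂ) * z‖ ^ 2 := by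
      have h0 := norm_nonneg ((t : ℂ) * z)
      have h1 : ‖(t : ℂ) * z‖ ≤ t :=
        (hnorm t ht').trans (mul_le_of_le_one_right (hs0.trans ht.1) hz1.le)
      nlinarith [ht.2]
    rw [norm_mul]
    calc ‖deriv f (t * z)‖ * ‖z‖ ≤ ‖deriv f (t * z)‖ :=
          mul_le_of_le_one_right (norm_nonneg _) hz1.le
      _ ≤ blochNorm α f * (1 - ‖(t : ℂ) * z‖ ^ 2) ^ (-α) := hf.norm_deriv_le (hmem t ht')
      _ ≤ blochNorm α f * (1 - t) ^ (-α) :=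
          mul_le_mul_of_nonneg_left
            (Real.rpow_le_rpow_of_nonpos ht1 hle (neg_nonpos.2 hα0.le)) hnn

lemma MemBloch.norm_le {α : ℝ} (hα0 : 0 < α) (hα1 : α < 1) {f : ℂ → ℂ}
    (hf : MemBloch α f) {z : ℂ} (hz : z ∈ unitDisk) :
    ‖f z‖ ≤ blochNorm α f + blochNorm α f / (1 - α) := by
  have h := hf.norm_sub_dilation_le hα0 hα1 le_rfl zero_le_one hz
  simp only [ofReal_zero, zero_mul, sub_zero, Real.one_rpow, mul_one] at h
  calc ‖f z‖ ≤ ‖f 0‖ + ‖f z - f 0‖ := norm_le_norm_add_norm_sub' _ _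
    _ ≤ _ := add_le_add (norm_apply_zero_le_blochNorm α f) h

/-- Bloch type functions are Lipschitz on smaller concentric disks. -/
lemma MemBloch.norm_sub_le {α : ℝ} (hα0 : 0 < α) {f : ℂ → ℂ} (hf : MemBloch α f)
    {s : ℝ} (hs0 : 0 ≤ s) (hs1 : s < 1) {z w : ℂ} (hz : z ∈ Metric.closedBall (0 : ℂ) s)
    (hw : w ∈ Metric.closedBall (0 : ℂ) s) :
    ‖f z - f w‖ ≤ blochNorm α f * (1 - s ^ 2) ^ (-α) * ‖z - w‖ := by
  have hnn : 0 ≤ blochNorm α f := (norm_nonneg _).trans (norm_apply_zero_le_blochNorm α f)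
  have hsub : Metric.closedBall (0 : ℂ) s ⊆ unitDisk := Metric.closedBall_subset_ball hs1
  refine (convex_closedBall (0 : ℂ) s).norm_image_sub_le_of_norm_deriv_le
    (fun x hx => hf.1.differentiableAt (Metric.isOpen_ball.mem_nhds (hsub hx)))
    (fun x hx => (hf.norm_deriv_le (hsub hx)).trans ?_) hw hz
  have hx' := mem_closedBall_zero_iff.1 hx
  refine mul_le_mul_of_nonneg_left
    (Real.rpow_le_rpow_of_nonpos (by nlinarith) ?_ (neg_nonpos.2 hα0.le)) hnn
  gcongr

/-- Finitely many points of the disk detect, up to `ε`, all values of the functions in a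
ball of `B^α`, when `α < 1`. -/
lemma exists_finite_net_of_blochNorm_le {α : ℝ} (hα0 : 0 < α) (hα1 : α < 1) (r : ℝ) {ε : ℝ}
    (hε : 0 < ε) :
    ∃ N ⊆ unitDisk, N.Finite ∧ ∀ z ∈ unitDisk, ∃ w ∈ N, ∀ f, MemBloch α f →
      blochNorm α f ≤ r → ‖f z - f w‖ ≤ ε := by
  have hα : 0 < 1 - α := sub_pos.2 hα1
  obtain ⟨s, hs0, hs1, hs⟩ : ∃ s : ℝ, 0 ≤ s ∧ s < 1 ∧ r * (1 - s) ^ (1 - α) / (1 - α) < ε / 2 := by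
    have hc : ContinuousAt (fun s : ℝ => r * (1 - s) ^ (1 - α) / (1 - α)) 1 :=
      (continuousAt_const.mul ((continuousAt_const.sub continuousAt_id).rpow_const
        (Or.inr hα.le))).div_const _
    have h1 : ∀ᶠ s in nhdsWithin (1 : ℝ) (Iio 1), r * (1 - s) ^ (1 - α) / (1 - α) < ε / 2 :=
      (hc.eventually_lt continuousAt_const
        (by simpa [Real.zero_rpow hα.ne'] using hε)).filter_mono nhdsWithin_le_nhds
    obtain ⟨s, hs, hs'⟩ := (h1.and (Ioo_mem_nhdsLT (zero_lt_one' ℝ))).exists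
    exact ⟨s, hs'.1.le, hs'.2, hs⟩
  have hL : 0 < (1 - s ^ 2) ^ (-α) := Real.rpow_pos_of_pos (by nlinarith) _
  have hr : 0 < |r| + 1 := by positivity
  have hδ : 0 < ε / 2 / ((|r| + 1) * (1 - s ^ 2) ^ (-α)) := by positivity
  obtain ⟨N, hNs, hN, hcov⟩ := Metric.finite_approx_of_totallyBounded
    (isCompact_closedBall (0 : ℂ) s).totallyBounded _ hδ
  refine ⟨N, hNs.trans (Metric.closedBall_subset_ball hs1), hN, fun z hz => ?_⟩
  have hsz : (s : ℂ) * z ∈ Metric.closedBall (0 : ℂ) s := by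
    rw [mem_closedBall_zero_iff, norm_mul, norm_real, Real.norm_of_nonneg hs0]
    exact mul_le_of_le_one_right hs0 (mem_ball_zero_iff.1 hz).le
  obtain ⟨w, hwN, hw⟩ := mem_iUnion₂.1 (hcov hsz)
  refine ⟨w, hwN, fun f hf hfr => ?_⟩
  rw [Metric.mem_ball, dist_eq_norm, lt_div_iff₀ (by positivity)] at hw
  have h1 : ‖f z - f (s * z)‖ ≤ ε / 2 := by
    refine (hf.norm_sub_dilation_le hα0 hα1 hs0 hs1.le hz).trans (le_trans ?_ hs.le)
    have := Real.rpow_nonneg (sub_nonneg.2 hs1.le) (1 - α)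
    gcongr
  have h2 : ‖f (s * z) - f w‖ ≤ ε / 2 := by
    refine (hf.norm_sub_le hα0 hs0 hs1 hsz (hNs hwN)).trans (le_trans ?_ hw.le)
    rw [mul_comm]
    gcongr
    linarith [le_abs_self r]
  calc ‖f z - f w‖ ≤ ‖f z - f (s * z)‖ + ‖f (s * z) - f w‖ := norm_sub_le_norm_sub_add_norm_sub ..
    _ ≤ ε := by linarith

/-- For `α < 1`, balls of `B^α` are totally bounded in the supremum norm. -/
lemma exists_finite_approx_of_blochNorm_le {α : ℝ} (hα0 : 0 < α) (hα1 : α < 1) (r : ℝ) {ε : ℝ}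
    (hε : 0 < ε) :
    ∃ T : Set (ℂ → ℂ), T.Finite ∧ (∀ g ∈ T, MemBloch α g) ∧ ∀ f, MemBloch α f →
      blochNorm α f ≤ r → ∃ g ∈ T, ∀ z ∈ unitDisk, ‖f z - g z‖ ≤ ε := by
  have hα : 0 < 1 - α := sub_pos.2 hα1
  obtain ⟨N, hND, hN, hnet⟩ := exists_finite_net_of_blochNorm_le hα0 hα1 r
    (show 0 < ε / 3 by positivity)
  obtain ⟨T, hTF, hT, happ⟩ := exists_finite_subset_approx
    {f | MemBloch α f ∧ blochNorm α f ≤ r} hN (r + r / (1 - α))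
    (fun f hf z hz => (hf.1.norm_le hα0 hα1 (hND hz)).trans (by have := hf.2; gcongr))
    (show 0 < ε / 3 by positivity)
  refine ⟨T, hT, fun g hg => (hTF hg).1, fun f hf hfr => ?_⟩
  obtain ⟨g, hg, hfg⟩ := happ f ⟨hf, hfr⟩
  refine ⟨g, hg, fun z hz => ?_⟩
  obtain ⟨w, hw, hzw⟩ := hnet z hz
  have h1 := hzw f hf hfr
  have h2 := hzw g (hTF hg).1 (hTF hg).2
  have h3 := hfg w hw
  calc ‖f z - g z‖ = ‖(f z - f w) + (f w - g w) - (g z - g w)‖ := by congr 1; ring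
    _ ≤ ‖f z - f w‖ + ‖f w - g w‖ + ‖g z - g w‖ :=
        (norm_sub_le _ _).trans (add_le_add_left (norm_add_le _ _) _)
    _ ≤ ε := by linarith

lemma memBloch_const (α : ℝ) (c : ℂ) : MemBloch α fun _ => c := by
  refine ⟨differentiableOn_const c, 0, ?_⟩
  rintro _ ⟨z, -, rfl⟩
  simp

/-- **Lemma 4.2 (i)**. For `0 < α < 1`, if `uC_φ : B^α → H^∞_ν_β` is bounded then it is
compact. -/
theorem weighted_comp_compact_Bloch_to_weighted_of_lt_one
    (α β : ℝ) (hα0 : 0 < α) (hα1 : α < 1) (hβ : 0 < β)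
    (u φ : ℂ → ℂ) (hu : DifferentiableOn ℂ u unitDisk)
    (hφd : DifferentiableOn ℂ φ unitDisk) (hφm : Set.MapsTo φ unitDisk unitDisk)
    (hb : BoundedBlochToWeighted α β u φ) :
    CompactBlochToWeighted α β u φ := by
  refine ⟨hb, fun r ε hε => ?_⟩
  classical
  obtain ⟨M, hM⟩ := (hb.1 _ (memBloch_const α 1)).2
  have hM' : ∀ z ∈ unitDisk, (1 - ‖z‖ ^ 2) ^ β * ‖u z‖ ≤ |M| + 1 := fun z hz => by
    have := hM (mem_image_of_mem _ hz)
    simp only [wcomp, mul_one] at this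
    linarith [le_abs_self M]
  have hMpos : 0 < |M| + 1 := by positivity
  obtain ⟨T, hT, hTB, happ⟩ := exists_finite_approx_of_blochNorm_le hα0 hα1 r (div_pos hε hMpos)
  refine ⟨hT.toFinset.image (wcomp u φ), fun g hg => ?_, fun f hf hfr => ?_⟩
  · obtain ⟨h, hh, rfl⟩ := Finset.mem_image.1 hg
    exact hb.1 h (hTB h (hT.mem_toFinset.1 hh))
  · obtain ⟨g, hg, hfg⟩ := happ f hf hfr
    refine ⟨_, Finset.mem_image_of_mem _ (hT.mem_toFinset.2 hg), Real.sSup_le ?_ hε.le⟩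
    rintro _ ⟨z, hz, rfl⟩
    calc (1 - ‖z‖ ^ 2) ^ β * ‖wcomp u φ f z - wcomp u φ g z‖
        = (1 - ‖z‖ ^ 2) ^ β * ‖u z‖ * ‖f (φ z) - g (φ z)‖ := by
          rw [wcomp, wcomp, ← mul_sub, norm_mul, mul_assoc]
      _ ≤ (|M| + 1) * (ε / (|M| + 1)) :=
          mul_le_mul (hM' z hz) (hfg _ (hφm hz)) (norm_nonneg _) hMpos.le
      _ = ε := mul_div_cancel₀ _ hMpos.ne'

end
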